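/- arXiv:1704.07819 — 2 statements merged into one kernel-verified Lean document; each statement's English description precedes it below -/
import Mathlib

section
/- For an invertible linear endomorphism g of ℂ⁷ the following are equivalent: (i) g(X × Y) = g(X) × g(Y) for all X, Y ∈ ℂ⁷; (ii) Ω₀(gX, gY, gZ) = Ω₀(X,Y,Z) for all X, Y, Z and det g = 1; (iii) Ω₀(gX, gY, gZ) = Ω₀(X,Y,Z) for all X, Y, Z and n(gX, gY) = n(X,Y) for all X, Y. That is, Aut(ℂ⁷, ×) = G_{Ω₀} ∩ SL₇(ℂ) = G_{Ω₀} ∩ O(ℂ⁷, n). -/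
open Matrix

noncomputable section

/-- `ℂ⁷`, identified with `ℂ × ℂ³ × ℂ³`, elements written `(s, u, v)`. -/
abbrev V7 := ℂ × (Fin 3 → ℂ) × (Fin 3 → ℂ)

/-- The quadratic form `n(s,u,v) = -s² - 4 uᵀv` on `ℂ⁷`. -/
def nq (X : V7) : ℂ := -X.1 ^ 2 - 4 * (X.2.1 ⬝ᵥ X.2.2)

/-- The symmetric bilinear form associated to `n` by polarization. -/
def nb (X Y : V7) : ℂ := (nq (X + Y) - nq X - nq Y) / 2

/-- The bilinear product `×` on `ℂ⁷`. -/
def cr (X Y : V7) : V7 :=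
  (2 * (X.2.1 ⬝ᵥ Y.2.2) - 2 * (X.2.2 ⬝ᵥ Y.2.1),
   X.1 • Y.2.1 - Y.1 • X.2.1 - (2 : ℂ) • (crossProduct X.2.2 Y.2.2),
   -(X.1 • Y.2.2) + Y.1 • X.2.2 + (2 : ℂ) • (crossProduct X.2.1 Y.2.1))

/-- The alternating 3-form `Ω₀(X,Y,Z) = n(X × Y, Z)` on `ℂ⁷`. -/
def Omega0 (X Y Z : V7) : ℂ := nb (cr X Y) Z

/-- The Pfaffian of an alternating `6 × 6` matrix, read off its entries above the diagonal. -/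
def pfaffianSix (B : Matrix (Fin 6) (Fin 6) ℂ) : ℂ :=
  B 0 1 * (B 2 3 * B 4 5 - B 2 4 * B 3 5 + B 2 5 * B 3 4)
  - B 0 2 * (B 1 3 * B 4 5 - B 1 4 * B 3 5 + B 1 5 * B 3 4)
  + B 0 3 * (B 1 2 * B 4 5 - B 1 4 * B 2 5 + B 1 5 * B 2 4)
  - B 0 4 * (B 1 2 * B 3 5 - B 1 3 * B 2 5 + B 1 5 * B 2 3)
  + B 0 5 * (B 1 2 * B 3 4 - B 1 3 * B 2 4 + B 1 4 * B 2 3)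

/-- The vector of signed principal sub-Pfaffians of an alternating `7 × 7` matrix. -/
def pfaffianVec (A : Matrix (Fin 7) (Fin 7) ℂ) (i : Fin 7) : ℂ :=
  (-1) ^ (i : ℕ) * pfaffianSix (A.submatrix i.succAbove i.succAbove)

lemma pfaffianVec_eq (A : Matrix (Fin 7) (Fin 7) ℂ) :
    pfaffianVec A = ![
      (A 1 2 * (A 3 4 * A 5 6 - A 3 5 * A 4 6 + A 3 6 * A 4 5)
         - A 1 3 * (A 2 4 * A 5 6 - A 2 5 * A 4 6 + A 2 6 * A 4 5)
         + A 1 4 * (A 2 3 * A 5 6 - A 2 5 * A 3 6 + A 2 6 * A 3 5)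
         - A 1 5 * (A 2 3 * A 4 6 - A 2 4 * A 3 6 + A 2 6 * A 3 4)
         + A 1 6 * (A 2 3 * A 4 5 - A 2 4 * A 3 5 + A 2 5 * A 3 4)),
      -(A 0 2 * (A 3 4 * A 5 6 - A 3 5 * A 4 6 + A 3 6 * A 4 5)
         - A 0 3 * (A 2 4 * A 5 6 - A 2 5 * A 4 6 + A 2 6 * A 4 5)
         + A 0 4 * (A 2 3 * A 5 6 - A 2 5 * A 3 6 + A 2 6 * A 3 5)
         - A 0 5 * (A 2 3 * A 4 6 - A 2 4 * A 3 6 + A 2 6 * A 3 4)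
         + A 0 6 * (A 2 3 * A 4 5 - A 2 4 * A 3 5 + A 2 5 * A 3 4)),
      (A 0 1 * (A 3 4 * A 5 6 - A 3 5 * A 4 6 + A 3 6 * A 4 5)
         - A 0 3 * (A 1 4 * A 5 6 - A 1 5 * A 4 6 + A 1 6 * A 4 5)
         + A 0 4 * (A 1 3 * A 5 6 - A 1 5 * A 3 6 + A 1 6 * A 3 5)
         - A 0 5 * (A 1 3 * A 4 6 - A 1 4 * A 3 6 + A 1 6 * A 3 4)
         + A 0 6 * (A 1 3 * A 4 5 - A 1 4 * A 3 5 + A 1 5 * A 3 4)),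
      -(A 0 1 * (A 2 4 * A 5 6 - A 2 5 * A 4 6 + A 2 6 * A 4 5)
         - A 0 2 * (A 1 4 * A 5 6 - A 1 5 * A 4 6 + A 1 6 * A 4 5)
         + A 0 4 * (A 1 2 * A 5 6 - A 1 5 * A 2 6 + A 1 6 * A 2 5)
         - A 0 5 * (A 1 2 * A 4 6 - A 1 4 * A 2 6 + A 1 6 * A 2 4)
         + A 0 6 * (A 1 2 * A 4 5 - A 1 4 * A 2 5 + A 1 5 * A 2 4)),
      (A 0 1 * (A 2 3 * A 5 6 - A 2 5 * A 3 6 + A 2 6 * A 3 5)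
         - A 0 2 * (A 1 3 * A 5 6 - A 1 5 * A 3 6 + A 1 6 * A 3 5)
         + A 0 3 * (A 1 2 * A 5 6 - A 1 5 * A 2 6 + A 1 6 * A 2 5)
         - A 0 5 * (A 1 2 * A 3 6 - A 1 3 * A 2 6 + A 1 6 * A 2 3)
         + A 0 6 * (A 1 2 * A 3 5 - A 1 3 * A 2 5 + A 1 5 * A 2 3)),
      -(A 0 1 * (A 2 3 * A 4 6 - A 2 4 * A 3 6 + A 2 6 * A 3 4)
         - A 0 2 * (A 1 3 * A 4 6 - A 1 4 * A 3 6 + A 1 6 * A 3 4)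
         + A 0 3 * (A 1 2 * A 4 6 - A 1 4 * A 2 6 + A 1 6 * A 2 4)
         - A 0 4 * (A 1 2 * A 3 6 - A 1 3 * A 2 6 + A 1 6 * A 2 3)
         + A 0 6 * (A 1 2 * A 3 4 - A 1 3 * A 2 4 + A 1 4 * A 2 3)),
      (A 0 1 * (A 2 3 * A 4 5 - A 2 4 * A 3 5 + A 2 5 * A 3 4)
         - A 0 2 * (A 1 3 * A 4 5 - A 1 4 * A 3 5 + A 1 5 * A 3 4)
         + A 0 3 * (A 1 2 * A 4 5 - A 1 4 * A 2 5 + A 1 5 * A 2 4)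
         - A 0 4 * (A 1 2 * A 3 5 - A 1 3 * A 2 5 + A 1 5 * A 2 3)
         + A 0 5 * (A 1 2 * A 3 4 - A 1 3 * A 2 4 + A 1 4 * A 2 3))] := by
  ext i
  fin_cases i <;> simp [pfaffianVec, pfaffianSix, Fin.succAbove, Fin.lt_def] <;> ring

lemma transpose_mul_mul_transpose_eq_neg {A : Matrix (Fin 7) (Fin 7) ℂ} (hA : Aᵀ = -A)
    (M : Matrix (Fin 7) (Fin 7) ℂ) : (Mᵀ * A * M)ᵀ = -(Mᵀ * A * M) := by
  simp [Matrix.transpose_mul, hA, Matrix.mul_assoc]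

lemma mulVec_pfaffianVec_diagonal (A : Matrix (Fin 7) (Fin 7) ℂ) (D : Fin 7 → ℂ) :
    diagonal D *ᵥ pfaffianVec ((diagonal D)ᵀ * A * diagonal D) =
      (diagonal D).det • pfaffianVec A := by
  ext i
  simp only [diagonal_transpose, mulVec_diagonal, det_diagonal, Fin.prod_univ_seven,
    pfaffianVec_eq, mul_diagonal, diagonal_mul, Pi.smul_apply, smul_eq_mul]
  fin_cases i <;> simp <;> ring

set_option maxHeartbeats 4000000 in
lemma mulVec_pfaffianVec_transvection {A : Matrix (Fin 7) (Fin 7) ℂ} (hA : Aᵀ = -A)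
    {i j : Fin 7} (hij : i ≠ j) (c : ℂ) :
    transvection i j c *ᵥ pfaffianVec ((transvection i j c)ᵀ * A * transvection i j c) =
      pfaffianVec A := by
  have hs : ∀ k l, A k l = -A l k := fun k l => by
    simpa using congrFun (congrFun hA l) k
  have hd : ∀ k, A k k = 0 := fun k => self_eq_neg.mp (hs k k)
  have he : ∀ k l, ((transvection i j c)ᵀ * A * transvection i j c) k l =
      A k l + (if k = j then c * A i l else 0) + (if l = j then c * A k i else 0) := by
    intro k l
    by_cases hk : k = j <;> by_cases hl : l = j <;>
      simp [transvection, Matrix.add_mul, Matrix.mul_add, hk, hl, hd, mul_comm c, add_comm]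
  have hv : ∀ v, transvection i j c *ᵥ v = v + Pi.single i (c * v j) := by
    intro v
    ext k
    simp [transvection, Matrix.add_mulVec, single_mulVec, Function.update_apply, Pi.single_apply]
  rw [hv, pfaffianVec_eq, pfaffianVec_eq]
  simp only [he]
  ext k
  fin_cases i <;> fin_cases j <;> first | exact absurd rfl hij | skip
  all_goals
    fin_cases k <;>
    simp [hd, hs 1 0, hs 2 0, hs 3 0, hs 4 0, hs 5 0, hs 2 1, hs 3 1, hs 4 1, hs 5 1,
      hs 6 1, hs 3 2, hs 4 2, hs 5 2, hs 6 2, hs 4 3, hs 5 3, hs 6 3, hs 5 4, hs 6 4, hs 6 5] <;>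
    ring

/-- The sub-Pfaffian vector transforms under congruence by `M` through the adjugate of `M`. -/
lemma mulVec_pfaffianVec (M : Matrix (Fin 7) (Fin 7) ℂ) :
    ∀ A : Matrix (Fin 7) (Fin 7) ℂ, Aᵀ = -A →
      M *ᵥ pfaffianVec (Mᵀ * A * M) = M.det • pfaffianVec A := by
  induction M using diagonal_transvection_induction with
  | hdiag D _ => exact fun A _ => mulVec_pfaffianVec_diagonal A D
  | htransvec t =>
    intro A hA
    rw [t.det, one_smul]
    exact mulVec_pfaffianVec_transvection hA t.hij t.c
  | hmul M N hM hN =>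
    intro A hA
    have h : (M * N)ᵀ * A * (M * N) = Nᵀ * (Mᵀ * A * M) * N := by
      simp only [Matrix.transpose_mul, Matrix.mul_assoc]
    rw [h, ← mulVec_mulVec, hN _ (transpose_mul_mul_transpose_eq_neg hA M), mulVec_smul, hM A hA,
      smul_smul, det_mul, mul_comm]

/-- The coordinates `(s, u, v) ↔ (s, u₀, u₁, u₂, v₀, v₁, v₂)` on `V7`. -/
def coordEquiv : (Fin 7 → ℂ) ≃ₗ[ℂ] V7 where
  toFun w := (w 0, ![w 1, w 2, w 3], ![w 4, w 5, w 6])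
  invFun X := ![X.1, X.2.1 0, X.2.1 1, X.2.1 2, X.2.2 0, X.2.2 1, X.2.2 2]
  map_add' v w := by simp
  map_smul' c w := by simp
  left_inv w := by ext i; fin_cases i <;> rfl
  right_inv X := by
    refine Prod.ext rfl (Prod.ext ?_ ?_) <;> ext i <;> fin_cases i <;> rfl

lemma nb_eq (X Y : V7) :
    nb X Y = -(X.1 * Y.1) - 2 * (X.2.1 ⬝ᵥ Y.2.2 + X.2.2 ⬝ᵥ Y.2.1) := by
  simp only [nb, nq, Prod.fst_add, Prod.snd_add, add_dotProduct, dotProduct_add]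
  rw [dotProduct_comm Y.2.1 X.2.2]
  ring

lemma nb_self (X : V7) : nb X X = nq X := by
  rw [nb_eq, nq, dotProduct_comm X.2.2]
  ring

/-- The matrix of the alternating form `Ω₀(X, ·, ·)` in the coordinates `coordEquiv`. -/
def omegaMatrix (X : V7) : Matrix (Fin 7) (Fin 7) ℂ :=
  !![0, -2 * X.2.2 0, -2 * X.2.2 1, -2 * X.2.2 2, 2 * X.2.1 0, 2 * X.2.1 1, 2 * X.2.1 2;
    2 * X.2.2 0, 0, -4 * X.2.1 2, 4 * X.2.1 1, -2 * X.1, 0, 0;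
    2 * X.2.2 1, 4 * X.2.1 2, 0, -4 * X.2.1 0, 0, -2 * X.1, 0;
    2 * X.2.2 2, -4 * X.2.1 1, 4 * X.2.1 0, 0, 0, 0, -2 * X.1;
    -2 * X.2.1 0, 2 * X.1, 0, 0, 0, 4 * X.2.2 2, -4 * X.2.2 1;
    -2 * X.2.1 1, 0, 2 * X.1, 0, -4 * X.2.2 2, 0, 4 * X.2.2 0;
    -2 * X.2.1 2, 0, 0, 2 * X.1, 4 * X.2.2 1, -4 * X.2.2 0, 0]

lemma dotProduct_omegaMatrix_mulVec (X : V7) (v w : Fin 7 → ℂ) :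
    v ⬝ᵥ omegaMatrix X *ᵥ w = Omega0 X (coordEquiv v) (coordEquiv w) := by
  simp only [Omega0, nb_eq, cr, coordEquiv, omegaMatrix, cross_apply, LinearEquiv.coe_mk,
    LinearMap.coe_mk, AddHom.coe_mk]
  simp [dotProduct, mulVec, Fin.sum_univ_succ, vecHead, vecTail]
  ring

lemma omegaMatrix_transpose (X : V7) : (omegaMatrix X)ᵀ = -omegaMatrix X := by
  ext i j
  fin_cases i <;> fin_cases j <;> simp [omegaMatrix]

lemma pfaffianVec_omegaMatrix (X : V7) :
    pfaffianVec (omegaMatrix X) = (-8 * nq X) • coordEquiv.symm X := by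
  rw [pfaffianVec_eq]
  ext i
  fin_cases i <;> simp [omegaMatrix, coordEquiv, nq, dotProduct, Fin.sum_univ_succ] <;> ring

lemma ext_dotProduct_mulVec {A B : Matrix (Fin 7) (Fin 7) ℂ}
    (h : ∀ v w, v ⬝ᵥ A *ᵥ w = v ⬝ᵥ B *ᵥ w) : A = B := by
  ext i j
  simpa using h (Pi.single i 1) (Pi.single j 1)

lemma det_mul_nq_of_preserves_Omega0 (g : V7 ≃ₗ[ℂ] V7)
    (h : ∀ X Y Z : V7, Omega0 (g X) (g Y) (g Z) = Omega0 X Y Z) (X : V7) :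
    LinearMap.det (g : V7 →ₗ[ℂ] V7) * nq (g X) = nq X := by
  set f : (Fin 7 → ℂ) →ₗ[ℂ] (Fin 7 → ℂ) :=
    (coordEquiv.symm : V7 →ₗ[ℂ] (Fin 7 → ℂ)) ∘ₗ (g : V7 →ₗ[ℂ] V7) ∘ₗ coordEquiv with hf
  set M := LinearMap.toMatrix' f with hMdef
  have hM : ∀ v, coordEquiv (M *ᵥ v) = g (coordEquiv v) := by
    intro v
    rw [hMdef, LinearMap.toMatrix'_mulVec, hf]
    simp
  have hdet : M.det = LinearMap.det (g : V7 →ₗ[ℂ] V7) := by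
    rw [hMdef, LinearMap.det_toMatrix', hf]
    simpa using LinearMap.det_conj (g : V7 →ₗ[ℂ] V7) coordEquiv.symm
  have key : ∀ X, nq X = M.det * nq (g X) := by
    intro X
    have hA : Mᵀ * omegaMatrix (g X) * M = omegaMatrix X := by
      refine ext_dotProduct_mulVec fun v w => ?_
      rw [dotProduct_omegaMatrix_mulVec, ← h, ← hM, ← hM, ← dotProduct_omegaMatrix_mulVec,
        Matrix.mul_assoc, ← mulVec_mulVec, dotProduct_mulVec, vecMul_transpose, ← mulVec_mulVec]
    have hp := mulVec_pfaffianVec M _ (omegaMatrix_transpose (g X))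
    rw [hA, pfaffianVec_omegaMatrix, pfaffianVec_omegaMatrix, mulVec_smul] at hp
    have hp' := congrArg coordEquiv hp
    simp only [map_smul, hM, LinearEquiv.apply_symm_apply, smul_smul] at hp'
    by_cases hX : X = 0
    · simp [hX, nq]
    · have := smul_left_injective ℂ (by simpa using hX : g X ≠ 0) hp'
      linear_combination (-1 / 8) * this
  rw [← hdet, ← key]

lemma nb_right_nondegenerate {W W' : V7} (h : ∀ Z, nb W Z = nb W' Z) : W = W' := by
  refine Prod.ext ?_ (Prod.ext ?_ ?_)
  · simpa [nb_eq] using h (1, 0, 0)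
  · ext i
    simpa [nb_eq] using h (0, 0, Pi.single i 1)
  · ext i
    simpa [nb_eq] using h (0, Pi.single i 1, 0)

lemma cr_cr_self (X Y : V7) : cr X (cr X Y) = nb X Y • X - nq X • Y := by
  simp only [nb_eq, nq, cr, cross_apply]
  refine Prod.ext ?_ (Prod.ext ?_ ?_)
  · simp [dotProduct, Fin.sum_univ_succ]
    ring
  all_goals
    ext i
    fin_cases i <;> simp [dotProduct, Fin.sum_univ_succ, vecHead, vecTail] <;> ring

lemma nq_eq_of_preserves_cr (g : V7 ≃ₗ[ℂ] V7) (h : ∀ X Y : V7, g (cr X Y) = cr (g X) (g Y))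
    (X : V7) : nq (g X) = nq X := by
  by_contra hne
  have hs : ∀ Y, (nq (g X) - nq X) • Y = (nb (g X) (g Y) - nb X Y) • X := by
    intro Y
    apply g.injective
    have h1 := h X (cr X Y)
    rw [h X Y, cr_cr_self, cr_cr_self, map_sub, map_smul, map_smul] at h1
    rw [map_smul, map_smul]
    linear_combination (norm := module) h1
  have hd : nq (g X) - nq X ≠ 0 := sub_ne_zero.mpr hne
  have h1 := hs (1, 0, 0)
  have h2 := hs (0, Pi.single 0 1, 0)
  generalize nb (g X) _ - nb X _ = a at h1
  generalize nb (g X) _ - nb X _ = b at h2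
  have h11 := congrArg Prod.fst h1
  have h12 := congrArg (fun Z : V7 => Z.2.1 0) h1
  have h22 := congrArg (fun Z : V7 => Z.2.1 0) h2
  simp only [Prod.smul_fst, Prod.smul_snd, Pi.smul_apply, Pi.zero_apply, Pi.single_eq_same,
    smul_eq_mul, mul_one, mul_zero] at h11 h12 h22
  grind

lemma nb_eq_of_nq_eq (g : V7 ≃ₗ[ℂ] V7) (h : ∀ X, nq (g X) = nq X) (X Y : V7) :
    nb (g X) (g Y) = nb X Y := by
  simp only [nb, ← map_add, h]

/-- for an invertible linear endomorphism `g` of `ℂ⁷` the following are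
equivalent: (i) `g` preserves the cross product `×`; (ii) `g` preserves `Ω₀` and
`det g = 1`; (iii) `g` preserves `Ω₀` and the bilinear form `n`. That is,
`Aut(ℂ⁷, ×) = G_{Ω₀} ∩ SL₇(ℂ) = G_{Ω₀} ∩ O(ℂ⁷, n)`. -/
theorem stmt16 :
    ∀ g : V7 ≃ₗ[ℂ] V7,
      ((∀ X Y : V7, g (cr X Y) = cr (g X) (g Y)) ↔
        ((∀ X Y Z : V7, Omega0 (g X) (g Y) (g Z) = Omega0 X Y Z) ∧
          LinearMap.det (g : V7 →ₗ[ℂ] V7) = 1)) ∧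
      ((∀ X Y : V7, g (cr X Y) = cr (g X) (g Y)) ↔
        ((∀ X Y Z : V7, Omega0 (g X) (g Y) (g Z) = Omega0 X Y Z) ∧
          ∀ X Y : V7, nb (g X) (g Y) = nb X Y)) := by
  intro g
  have cr_iff : (∀ X Y : V7, g (cr X Y) = cr (g X) (g Y)) ↔
      ((∀ X Y Z : V7, Omega0 (g X) (g Y) (g Z) = Omega0 X Y Z) ∧
        ∀ X Y : V7, nb (g X) (g Y) = nb X Y) := by
    constructor
    · intro h
      have hn := nb_eq_of_nq_eq g (nq_eq_of_preserves_cr g h)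
      exact ⟨fun X Y Z => by rw [Omega0, ← h, hn, Omega0], hn⟩
    · rintro ⟨hΩ, hn⟩ X Y
      refine nb_right_nondegenerate fun Z => ?_
      obtain ⟨Z, rfl⟩ := g.surjective Z
      rw [hn]
      exact (hΩ X Y Z).symm
  refine ⟨cr_iff.trans (and_congr_right fun hΩ => ?_), cr_iff⟩
  have hdet := det_mul_nq_of_preserves_Omega0 g hΩ
  constructor
  · intro hn
    have h1 := hdet (1, 0, 0)
    rw [← nb_self (g _), hn, nb_self] at h1
    simpa [nq] using h1
  · intro h1
    exact nb_eq_of_nq_eq g fun X => by rw [← hdet X, h1, one_mul]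
end
end

section
/- Every symmetric bilinear form q : ℂ⁷ × ℂ⁷ → ℂ satisfying q(M X, Y) + q(X, M Y) = 0 for every matrix M ∈ L_ℂ and all X, Y ∈ ℂ⁷ is a scalar multiple of the bilinear form n; that is, up to scalar multiple, n is the unique L_ℂ-invariant symmetric bilinear form on ℂ⁷. -/
open Matrix

noncomputable section

/-- The action on `ℂ⁷ = ℂ × ℂ³ × ℂ³` of the `7×7` block matrix
`M(a,x,y) = [[0, -2yᵀ, -2xᵀ], [x, a, l_y], [y, l_x, -aᵀ]] ∈ L_ℂ`. -/
def Mact (a : Matrix (Fin 3) (Fin 3) ℂ) (x y : Fin 3 → ℂ) (P : V7) : V7 :=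
  (-2 * (y ⬝ᵥ P.2.1) - 2 * (x ⬝ᵥ P.2.2),
   P.1 • x + a.mulVec P.2.1 + crossProduct y P.2.2,
   P.1 • y + crossProduct x P.2.1 - aᵀ.mulVec P.2.2)

/-- The explicit formula for the polarization of `nq`. -/
theorem nb_apply (X Y : V7) :
    nb X Y = -(X.1 * Y.1) - 2 * (X.2.1 ⬝ᵥ Y.2.2) - 2 * (Y.2.1 ⬝ᵥ X.2.2) := by
  simp only [nb, nq, Prod.fst_add, Prod.snd_add, add_dotProduct, dotProduct_add]
  ring

theorem eq_smul_add_add (X : V7) :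
    X = X.1 • ((1, 0, 0) : V7) + ((0, X.2.1, 0) : V7) + ((0, 0, X.2.2) : V7) := by
  ext <;> simp

theorem Mact_x_one (x : Fin 3 → ℂ) : Mact 0 x 0 (1, 0, 0) = (0, x, 0) := by
  simp [Mact]

theorem Mact_x_fst (x u : Fin 3 → ℂ) : Mact 0 x 0 (0, u, 0) = (0, 0, crossProduct x u) := by
  simp [Mact]

theorem Mact_x_snd (x v : Fin 3 → ℂ) :
    Mact 0 x 0 (0, 0, v) = (-2 * (x ⬝ᵥ v)) • ((1, 0, 0) : V7) := by
  simp [Mact]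

theorem Mact_y_one (y : Fin 3 → ℂ) : Mact 0 0 y (1, 0, 0) = (0, 0, y) := by
  simp [Mact]

theorem Mact_y_snd (y v : Fin 3 → ℂ) : Mact 0 0 y (0, 0, v) = (0, crossProduct y v, 0) := by
  simp [Mact]

/-- every symmetric bilinear form `q` on `ℂ⁷` that is invariant under
every `M ∈ L_ℂ` (i.e. `q(MX,Y) + q(X,MY) = 0`) is a scalar multiple of `n`. -/
theorem stmt17 :
    ∀ q : V7 → V7 → ℂ,
      (∀ X X' Y, q (X + X') Y = q X Y + q X' Y) →
      (∀ (c : ℂ) X Y, q (c • X) Y = c * q X Y) →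
      (∀ X Y Y', q X (Y + Y') = q X Y + q X Y') →
      (∀ (c : ℂ) X Y, q X (c • Y) = c * q X Y) →
      (∀ X Y, q X Y = q Y X) →
      (∀ (a : Matrix (Fin 3) (Fin 3) ℂ) (x y : Fin 3 → ℂ), Matrix.trace a = 0 →
        ∀ X Y, q (Mact a x y X) Y + q X (Mact a x y Y) = 0) →
      ∃ c : ℂ, ∀ X Y, q X Y = c * nb X Y := by
  intro q add_left smul_left add_right smul_right symm inv
  have inv_x x := inv 0 x 0 (trace_zero _ _)
  have inv_y y := inv 0 0 y (trace_zero _ _)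
  have one_fst (u) : q (1, 0, 0) (0, u, 0) = 0 := by
    have h := inv_x u (1, 0, 0) (1, 0, 0)
    rw [Mact_x_one, symm (0, u, 0)] at h
    linear_combination h / 2
  have one_snd (v) : q (1, 0, 0) (0, 0, v) = 0 := by
    have h := inv_y v (1, 0, 0) (1, 0, 0)
    rw [Mact_y_one, symm (0, 0, v)] at h
    linear_combination h / 2
  have fst_fst (u u') : q (0, u, 0) (0, u', 0) = 0 := by
    have h := inv_x u (1, 0, 0) (0, u', 0)
    rwa [Mact_x_one, Mact_x_fst, one_snd, add_zero] at h
  have snd_snd (v v') : q (0, 0, v) (0, 0, v') = 0 := by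
    have h := inv_y v (1, 0, 0) (0, 0, v')
    rwa [Mact_y_one, Mact_y_snd, one_fst, add_zero] at h
  have fst_snd (u v) : q (0, u, 0) (0, 0, v) = 2 * (u ⬝ᵥ v) * q (1, 0, 0) (1, 0, 0) := by
    have h := inv_x u (1, 0, 0) (0, 0, v)
    rw [Mact_x_one, Mact_x_snd, smul_right] at h
    linear_combination h
  refine ⟨-q (1, 0, 0) (1, 0, 0), fun X Y => ?_⟩
  rw [nb_apply, eq_smul_add_add X, eq_smul_add_add Y]
  simp only [add_left, add_right, smul_left, smul_right, symm _ (1, 0, 0), symm (0, 0, _) (0, _, 0),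
    one_fst, one_snd, fst_fst, snd_snd, fst_snd]
  simp
  ring
end
end
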